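/- arXiv:2404.07526 — 2 statements merged into one kernel-verified Lean document; each statement's English description precedes it below -/
import Mathlib

section
/- For every integer k ≥ 1, the matrices U_k and X_k are symmetric (U_kᵀ = U_k and X_kᵀ = X_k), and the identity U_k T_k − X_k B^k + X_k = T_kᵀ Hᵀ H T_k holds. -/
open Matrix Finset

/-- `T_k = I + B + ⋯ + B^{k-1}`. -/
noncomputable def Tmat {nu : ℕ} (B : Matrix (Fin nu) (Fin nu) ℝ) (k : ℕ) :
    Matrix (Fin nu) (Fin nu) ℝ :=
  ∑ j ∈ Finset.range k, B ^ j

/-- `U_k = Σ_{i+j=k-1} (Bᵀ)^i Hᵀ H B^j`. -/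
noncomputable def Umat {nu ng : ℕ} (B : Matrix (Fin nu) (Fin nu) ℝ)
    (H : Matrix (Fin ng) (Fin nu) ℝ) (k : ℕ) : Matrix (Fin nu) (Fin nu) ℝ :=
  ∑ i ∈ Finset.range k, (Bᵀ) ^ i * (Hᵀ * H) * B ^ (k - 1 - i)

/-- `X_k = Σ_{l=1}^{k-1} U_l` (so `X_1 = 0`). -/
noncomputable def Xmat {nu ng : ℕ} (B : Matrix (Fin nu) (Fin nu) ℝ)
    (H : Matrix (Fin ng) (Fin nu) ℝ) (k : ℕ) : Matrix (Fin nu) (Fin nu) ℝ :=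
  ∑ l ∈ Finset.Ico 1 k, Umat B H l

theorem Umat_zero {nu ng : ℕ} (B : Matrix (Fin nu) (Fin nu) ℝ)
    (H : Matrix (Fin ng) (Fin nu) ℝ) : Umat B H 0 = 0 := by
  simp [Umat]

theorem Umat_succ {nu ng : ℕ} (B : Matrix (Fin nu) (Fin nu) ℝ)
    (H : Matrix (Fin ng) (Fin nu) ℝ) (k : ℕ) :
    Umat B H (k + 1) = Bᵀ ^ k * (Hᵀ * H) + Umat B H k * B := by
  unfold Umat
  rw [Finset.sum_range_succ, add_comm, Finset.sum_mul]
  congr 1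
  · simp
  · refine Finset.sum_congr rfl fun i hi => ?_
    have hi' := Finset.mem_range.mp hi
    rw [show k + 1 - 1 - i = (k - 1 - i) + 1 by omega, pow_succ, mul_assoc _ _ B]

theorem Umat_transpose {nu ng : ℕ} (B : Matrix (Fin nu) (Fin nu) ℝ)
    (H : Matrix (Fin ng) (Fin nu) ℝ) (k : ℕ) : (Umat B H k)ᵀ = Umat B H k := by
  unfold Umat
  rw [Matrix.transpose_sum, ← Finset.sum_range_reflect]
  refine Finset.sum_congr rfl fun i hi => ?_
  have hi' := Finset.mem_range.mp hi
  rw [show k - 1 - (k - 1 - i) = i by omega]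
  simp only [Matrix.transpose_mul, Matrix.transpose_pow, Matrix.transpose_transpose,
    Matrix.mul_assoc]

theorem Xmat_transpose {nu ng : ℕ} (B : Matrix (Fin nu) (Fin nu) ℝ)
    (H : Matrix (Fin ng) (Fin nu) ℝ) (k : ℕ) : (Xmat B H k)ᵀ = Xmat B H k := by
  simp only [Xmat, Matrix.transpose_sum, Umat_transpose]

theorem Xmat_succ {nu ng : ℕ} (B : Matrix (Fin nu) (Fin nu) ℝ)
    (H : Matrix (Fin ng) (Fin nu) ℝ) (k : ℕ) :
    Xmat B H (k + 1) = Xmat B H k + Umat B H k := by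
  rcases Nat.eq_zero_or_pos k with rfl | hk
  · simp [Xmat, Umat_zero]
  · exact Finset.sum_Ico_succ_top hk _

theorem Tmat_succ {nu : ℕ} (B : Matrix (Fin nu) (Fin nu) ℝ) (k : ℕ) :
    Tmat B (k + 1) = Tmat B k + B ^ k :=
  Finset.sum_range_succ _ _

theorem mul_Tmat {nu : ℕ} (B : Matrix (Fin nu) (Fin nu) ℝ) (k : ℕ) :
    B * Tmat B k = Tmat B k - 1 + B ^ k := by
  have h := mul_geom_sum B k
  rw [sub_mul, one_mul] at h
  change B * Tmat B k - Tmat B k = B ^ k - 1 at h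
  rw [sub_eq_iff_eq_add.mp h]
  abel

theorem Umat_add_Xmat {nu ng : ℕ} (B : Matrix (Fin nu) (Fin nu) ℝ)
    (H : Matrix (Fin ng) (Fin nu) ℝ) (k : ℕ) :
    Umat B H k + Xmat B H k = Xmat B H k * B + (Tmat B k)ᵀ * (Hᵀ * H) := by
  induction k with
  | zero => simp [Umat, Xmat, Tmat]
  | succ k ih =>
    rw [Umat_succ, Xmat_succ, Tmat_succ, Matrix.transpose_add, Matrix.transpose_pow, add_mul,
      add_mul, add_comm (Xmat B H k), ih]
    abel

theorem Umat_mul_Tmat {nu ng : ℕ} (B : Matrix (Fin nu) (Fin nu) ℝ)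
    (H : Matrix (Fin ng) (Fin nu) ℝ) (k : ℕ) :
    Umat B H k * Tmat B k - Xmat B H k * B ^ k + Xmat B H k =
      (Tmat B k)ᵀ * (Hᵀ * H) * Tmat B k := by
  induction k with
  | zero => simp [Umat, Xmat, Tmat]
  | succ k ih =>
    have hX := congrArg (· * B ^ k) (Umat_add_Xmat B H k)
    simp only [add_mul, mul_assoc (Xmat B H k), ← pow_succ'] at hX
    have hU : Umat B H (k + 1) * Tmat B (k + 1) =
        Bᵀ ^ k * (Hᵀ * H) * Tmat B (k + 1) +
          (Umat B H k * Tmat B k + Umat B H k * B ^ k - Umat B H k +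
            Umat B H k * B ^ (k + 1)) := by
      rw [Umat_succ, add_mul, mul_assoc (Umat B H k), mul_Tmat, mul_add, mul_sub, mul_one,
        Tmat_succ B k, mul_add (Umat B H k)]
    have hT : (Tmat B (k + 1))ᵀ * (Hᵀ * H) * Tmat B (k + 1) =
        Bᵀ ^ k * (Hᵀ * H) * Tmat B (k + 1) +
          ((Tmat B k)ᵀ * (Hᵀ * H) * Tmat B k + (Tmat B k)ᵀ * (Hᵀ * H) * B ^ k) := by
      rw [← mul_add, ← Tmat_succ, ← add_mul, ← add_mul, add_comm (Bᵀ ^ k),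
        ← Matrix.transpose_pow, ← Matrix.transpose_add, ← Tmat_succ]
    rw [hU, hT, ← ih, Xmat_succ, add_mul, eq_sub_of_add_eq' hX.symm]
    abel

theorem stmt10 {nu ng : ℕ} (hu : 0 < nu) (hg : 0 < ng)
    (B : Matrix (Fin nu) (Fin nu) ℝ) (H : Matrix (Fin ng) (Fin nu) ℝ) :
    ∀ k : ℕ, 1 ≤ k →
      (Umat B H k)ᵀ = Umat B H k ∧
      (Xmat B H k)ᵀ = Xmat B H k ∧
      Umat B H k * Tmat B k - Xmat B H k * B ^ k + Xmat B H k =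
        (Tmat B k)ᵀ * Hᵀ * H * Tmat B k := by
  intro k _
  refine ⟨Umat_transpose B H k, Xmat_transpose B H k, ?_⟩
  rw [Umat_mul_Tmat, Matrix.mul_assoc (Tmat B k)ᵀ Hᵀ H]
end

section
/- Assume ‖B‖ < 1 and let k ≥ 1. If τ > 0 satisfies τ·(‖H‖²‖M‖²(1 − k‖B‖^{k−1} + (k−1)‖B‖^k)/((1−‖B‖)²(1−‖B‖^k)²) − α/2) < 1, then for every real λ with λ ≠ 1 and |λ| ≥ 1 and every y ∈ ℂ^{n_σ} with ‖y‖ = 1, one has (1+τα)λ² − λ + τ⟨Mᵀ(I − (Bᵀ)^k/λ)^{-1}[(λ−1)X_k + T_kᵀHᵀHT_k](I − B^k/λ)^{-1}My, y⟩ ≠ 0. -/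
open Matrix

/-- Euclidean norm of a vector with entries in `ℝ` or `ℂ`. -/
noncomputable def eNorm {𝕜 : Type*} [RCLike 𝕜] {n : ℕ} (x : Fin n → 𝕜) : ℝ :=
  Real.sqrt (∑ i, ‖x i‖ ^ 2)

/-- Operator (spectral) norm of a matrix, induced by the Euclidean vector norms. -/
noncomputable def opNorm {𝕜 : Type*} [RCLike 𝕜] {m n : ℕ} (A : Matrix (Fin m) (Fin n) 𝕜) : ℝ :=
  sSup {r : ℝ | ∃ x : Fin n → 𝕜, eNorm x = 1 ∧ r = eNorm (A.mulVec x)}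

section EuclideanBounds

variable {𝕜 : Type*} [RCLike 𝕜] {l m n : ℕ}

lemma eNorm_eq_norm_toLp (x : Fin n → 𝕜) : eNorm x = ‖WithLp.toLp 2 x‖ := by
  simp [eNorm, EuclideanSpace.norm_eq]

lemma eNorm_nonneg (x : Fin n → 𝕜) : 0 ≤ eNorm x := Real.sqrt_nonneg _

lemma eNorm_sq (x : Fin n → 𝕜) : eNorm x ^ 2 = ∑ i, ‖x i‖ ^ 2 :=
  Real.sq_sqrt (Finset.sum_nonneg fun _ _ => sq_nonneg _)

lemma eNorm_add_le (x y : Fin n → 𝕜) : eNorm (x + y) ≤ eNorm x + eNorm y := by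
  simpa only [eNorm_eq_norm_toLp, WithLp.toLp_add] using
    norm_add_le (WithLp.toLp 2 x) (WithLp.toLp 2 y)

lemma eNorm_smul (c : 𝕜) (x : Fin n → 𝕜) : eNorm (c • x) = ‖c‖ * eNorm x := by
  simpa only [eNorm_eq_norm_toLp, WithLp.toLp_smul] using norm_smul c (WithLp.toLp 2 x)

lemma norm_star_dotProduct_le (u v : Fin n → 𝕜) : ‖star u ⬝ᵥ v‖ ≤ eNorm u * eNorm v := by
  have h := norm_inner_le_norm (𝕜 := 𝕜) (WithLp.toLp 2 u) (WithLp.toLp 2 v)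
  rwa [EuclideanSpace.inner_toLp_toLp, dotProduct_comm, ← eNorm_eq_norm_toLp,
    ← eNorm_eq_norm_toLp] at h

lemma star_dotProduct_self (u : Fin n → 𝕜) : star u ⬝ᵥ u = ((eNorm u ^ 2 : ℝ) : 𝕜) := by
  rw [eNorm_sq]
  simp [dotProduct, RCLike.conj_mul]

lemma opNorm_nonneg (A : Matrix (Fin m) (Fin n) 𝕜) : 0 ≤ opNorm A :=
  Real.sSup_nonneg (by rintro _ ⟨x, -, rfl⟩; exact eNorm_nonneg _)

open scoped Matrix.Norms.L2Operator in
lemma eNorm_mulVec_le (A : Matrix (Fin m) (Fin n) 𝕜) (x : Fin n → 𝕜) :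
    eNorm (A *ᵥ x) ≤ opNorm A * eNorm x := by
  have bound : ∀ z : Fin n → 𝕜, eNorm (A *ᵥ z) ≤ ‖A‖ * eNorm z := fun z => by
    simpa only [eNorm_eq_norm_toLp] using! Matrix.l2_opNorm_mulVec A (WithLp.toLp 2 z)
  rcases (eNorm_nonneg x).eq_or_lt with hx | hx
  · simpa [← hx] using bound x
  · have hnorm : ‖((eNorm x)⁻¹ : 𝕜)‖ = (eNorm x)⁻¹ := by
      rw [norm_inv, RCLike.norm_ofReal, abs_of_pos hx]
    have hle : eNorm (A *ᵥ (((eNorm x)⁻¹ : 𝕜) • x)) ≤ opNorm A := by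
      refine le_csSup ⟨‖A‖, ?_⟩ ⟨_, ?_, rfl⟩
      · rintro _ ⟨z, hz, rfl⟩
        simpa [hz] using bound z
      · rw [eNorm_smul, hnorm, inv_mul_cancel₀ hx.ne']
    rwa [mulVec_smul, eNorm_smul, hnorm, inv_mul_le_iff₀ hx, mul_comm] at hle

/-- The operator norm of a real matrix also bounds its action on complex vectors. -/
lemma eNorm_map_ofReal_mulVec_le (A : Matrix (Fin m) (Fin n) ℝ) (x : Fin n → ℂ) :
    eNorm (A.map Complex.ofReal *ᵥ x) ≤ opNorm A * eNorm x := by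
  have split : ∀ {p : ℕ} (z : Fin p → ℂ),
      eNorm z ^ 2 = eNorm (fun i => (z i).re) ^ 2 + eNorm (fun i => (z i).im) ^ 2 := fun z => by
    simp only [eNorm_sq, ← Finset.sum_add_distrib, Complex.sq_norm, Complex.normSq_apply,
      Real.norm_eq_abs, sq_abs, ← pow_two]
  have hre : (fun i => ((A.map Complex.ofReal *ᵥ x) i).re) = A *ᵥ fun i => (x i).re := by
    ext i; simp [mulVec, dotProduct]
  have him : (fun i => ((A.map Complex.ofReal *ᵥ x) i).im) = A *ᵥ fun i => (x i).im := by
    ext i; simp [mulVec, dotProduct]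
  refine (sq_le_sq₀ (eNorm_nonneg _) (mul_nonneg (opNorm_nonneg A) (eNorm_nonneg x))).mp ?_
  rw [split, hre, him, mul_pow, split x, mul_add, ← mul_pow, ← mul_pow]
  exact add_le_add (pow_le_pow_left₀ (eNorm_nonneg _) (eNorm_mulVec_le A _) 2)
    (pow_le_pow_left₀ (eNorm_nonneg _) (eNorm_mulVec_le A _) 2)

lemma eNorm_map_ofReal_pow_mulVec_le (B : Matrix (Fin n) (Fin n) ℝ) (j : ℕ) (x : Fin n → ℂ) :
    eNorm ((B.map Complex.ofReal) ^ j *ᵥ x) ≤ opNorm B ^ j * eNorm x := by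
  induction j with
  | zero => simp
  | succ j ih =>
    rw [pow_succ', ← mulVec_mulVec, pow_succ', mul_assoc]
    exact (eNorm_map_ofReal_mulVec_le B _).trans
      (mul_le_mul_of_nonneg_left ih (opNorm_nonneg B))

lemma map_ofReal_transpose (A : Matrix (Fin m) (Fin n) ℝ) :
    (A.map Complex.ofReal)ᵀ = (A.map Complex.ofReal)ᴴ := by
  ext i j; simp

lemma star_dotProduct_conjTranspose_mul_mulVec (N : Matrix (Fin l) (Fin m) 𝕜)
    (P : Matrix (Fin l) (Fin n) 𝕜) (x : Fin m → 𝕜) (y : Fin n → 𝕜) :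
    star x ⬝ᵥ ((Nᴴ * P) *ᵥ y) = star (N *ᵥ x) ⬝ᵥ (P *ᵥ y) := by
  rw [← mulVec_mulVec, dotProduct_mulVec, star_mulVec]

end EuclideanBounds

section QuadraticForm

variable {nu nσ ng : ℕ}

lemma Umat_map_ofReal (B : Matrix (Fin nu) (Fin nu) ℝ) (H : Matrix (Fin ng) (Fin nu) ℝ) (k : ℕ) :
    (Umat B H k).map Complex.ofReal = ∑ i ∈ Finset.range k,
      (H.map Complex.ofReal * (B.map Complex.ofReal) ^ i)ᴴ *
        (H.map Complex.ofReal * (B.map Complex.ofReal) ^ (k - 1 - i)) := by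
  have hsum := map_sum (Complex.ofRealHom.mapMatrix (m := Fin nu))
    (fun i => (Bᵀ) ^ i * (Hᵀ * H) * B ^ (k - 1 - i)) (Finset.range k)
  refine hsum.trans (Finset.sum_congr rfl fun i _ => ?_)
  have hH : (Hᵀ * H).map Complex.ofReal = (H.map Complex.ofReal)ᴴ * H.map Complex.ofReal := by
    rw [← map_ofReal_transpose]
    exact Matrix.map_mul (f := Complex.ofRealHom)
  have hBt : Complex.ofRealHom.mapMatrix Bᵀ = (B.map Complex.ofReal)ᴴ :=
    map_ofReal_transpose B
  rw [map_mul, map_mul, map_pow, map_pow, hBt, conjTranspose_mul, conjTranspose_pow]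
  change _ * (Hᵀ * H).map Complex.ofReal * (B.map Complex.ofReal) ^ (k - 1 - i) = _
  rw [hH]
  simp only [Matrix.mul_assoc]

lemma norm_star_dotProduct_Umat_le (B : Matrix (Fin nu) (Fin nu) ℝ)
    (H : Matrix (Fin ng) (Fin nu) ℝ) (k : ℕ) (w : Fin nu → ℂ) :
    ‖star w ⬝ᵥ ((Umat B H k).map Complex.ofReal *ᵥ w)‖ ≤
      opNorm H ^ 2 * (k * opNorm B ^ (k - 1)) * eNorm w ^ 2 := by
  have hpow : ∀ j, eNorm ((H.map Complex.ofReal * (B.map Complex.ofReal) ^ j) *ᵥ w) ≤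
      opNorm H * (opNorm B ^ j * eNorm w) := fun j => by
    rw [← mulVec_mulVec]
    exact (eNorm_map_ofReal_mulVec_le H _).trans
      (mul_le_mul_of_nonneg_left (eNorm_map_ofReal_pow_mulVec_le B j w) (opNorm_nonneg H))
  rw [Umat_map_ofReal, sum_mulVec, dotProduct_sum]
  refine (norm_sum_le_of_le _ (f := fun i => _)
    (n := fun _ => opNorm H ^ 2 * opNorm B ^ (k - 1) * eNorm w ^ 2) fun i hi => ?_).trans
    (le_of_eq ?_)
  · rw [star_dotProduct_conjTranspose_mul_mulVec]
    refine (norm_star_dotProduct_le _ _).trans ((mul_le_mul (hpow i) (hpow (k - 1 - i))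
      (eNorm_nonneg _) ((eNorm_nonneg _).trans (hpow i))).trans (le_of_eq ?_))
    have hik : k - 1 = i + (k - 1 - i) := by have := Finset.mem_range.mp hi; omega
    conv_rhs => rw [hik, pow_add]
    ring
  · rw [Finset.sum_const, Finset.card_range, nsmul_eq_mul]
    ring

lemma sum_Ico_mul_pow_mul_one_sub_sq (b : ℝ) {k : ℕ} (hk : 1 ≤ k) :
    (∑ l ∈ Finset.Ico 1 k, (l : ℝ) * b ^ (l - 1)) * (1 - b) ^ 2 =
      1 - k * b ^ (k - 1) + ((k : ℝ) - 1) * b ^ k := by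
  induction k, hk using Nat.le_induction with
  | base => simp
  | succ k hk ih =>
    rw [Finset.sum_Ico_succ_top hk, add_mul, ih]
    obtain ⟨j, rfl⟩ := Nat.exists_eq_add_of_le' hk
    simp only [Nat.add_sub_cancel]
    push_cast
    ring

lemma norm_star_dotProduct_Xmat_le (B : Matrix (Fin nu) (Fin nu) ℝ)
    (H : Matrix (Fin ng) (Fin nu) ℝ) (k : ℕ) (w : Fin nu → ℂ) :
    ‖star w ⬝ᵥ ((Xmat B H k).map Complex.ofReal *ᵥ w)‖ ≤
      opNorm H ^ 2 * (∑ l ∈ Finset.Ico 1 k, (l : ℝ) * opNorm B ^ (l - 1)) * eNorm w ^ 2 := by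
  have hsum : (Xmat B H k).map Complex.ofReal =
      ∑ l ∈ Finset.Ico 1 k, (Umat B H l).map Complex.ofReal :=
    map_sum (Complex.ofRealHom.mapMatrix (m := Fin nu)) _ _
  rw [hsum, sum_mulVec, dotProduct_sum, Finset.mul_sum, Finset.sum_mul]
  exact norm_sum_le_of_le _ fun l _ => norm_star_dotProduct_Umat_le B H l w

lemma eNorm_resolvent_mulVec_le (B : Matrix (Fin nu) (Fin nu) ℝ) (k : ℕ)
    {c : ℂ} (hc : ‖c‖ ≤ 1) (v : Fin nu → ℂ) :
    eNorm ((1 - c • (B.map Complex.ofReal) ^ k)⁻¹ *ᵥ v) * (1 - opNorm B ^ k) ≤ eNorm v := by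
  set P := c • (B.map Complex.ofReal) ^ k with hP
  by_cases hdet : IsUnit (1 - P).det
  · set w := (1 - P)⁻¹ *ᵥ v with hw
    have hv : w = v + P *ᵥ w := by
      have : (1 - P) *ᵥ w = v := by
        rw [hw, mulVec_mulVec, mul_nonsing_inv _ hdet, one_mulVec]
      rw [← this, sub_mulVec, one_mulVec, sub_add_cancel]
    have hPw : eNorm (P *ᵥ w) ≤ opNorm B ^ k * eNorm w := by
      rw [hP, smul_mulVec, eNorm_smul]
      exact (mul_le_of_le_one_left (eNorm_nonneg _) hc).trans
        (eNorm_map_ofReal_pow_mulVec_le B k w)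
    have hadd := eNorm_add_le v (P *ᵥ w)
    rw [← hv] at hadd
    linarith
  · rw [nonsing_inv_apply_not_isUnit _ hdet, zero_mulVec]
    have : eNorm (0 : Fin nu → ℂ) = 0 := by simp [eNorm]
    rw [this, zero_mul]
    exact eNorm_nonneg v

end QuadraticForm

/-- Positivity of the quadratic in the real spectral parameter, for a cross term `q` that is small
compared with `1 + s / 2`. -/
lemma quadratic_pos_of_abs_lt {s q t lam : ℝ} (hs : 0 ≤ s) (hq : |q| < 1 + s / 2) (ht : 0 ≤ t)
    (hne : lam ≠ 1) (hlam : 1 ≤ |lam|) :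
    0 < (1 + s) * lam ^ 2 - lam + ((lam - 1) * q + t) := by
  obtain ⟨hq₁, hq₂⟩ := abs_lt.mp hq
  rcases le_abs.mp hlam with h | h
  · have h1 : 0 < lam - 1 := sub_pos.mpr (lt_of_le_of_ne h hne.symm)
    nlinarith [mul_pos h1 (by linarith : 0 < q + (1 + s / 2)),
      mul_nonneg hs (by nlinarith [sq_nonneg (lam - 1)] : 0 ≤ lam ^ 2 - (lam - 1) / 2)]
  · have h1 : 0 < 1 - lam := by linarith
    nlinarith [mul_pos h1 (by linarith : 0 < (1 + s / 2) - q),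
      mul_nonneg hs (by nlinarith : 0 ≤ lam ^ 2 - (1 - lam) / 2)]

theorem stmt13 {nu nσ ng : ℕ} (hu : 0 < nu) (hσ : 0 < nσ) (hg : 0 < ng)
    (B : Matrix (Fin nu) (Fin nu) ℝ) (M : Matrix (Fin nu) (Fin nσ) ℝ)
    (H : Matrix (Fin ng) (Fin nu) ℝ)
    (hB : opNorm B < 1)
    (hInj : Function.Injective (H * (1 - B)⁻¹ * M).mulVec)
    (α : ℝ) (hα : 0 ≤ α)
    (k : ℕ) (hk : 1 ≤ k)
    (τ : ℝ) (hτ : 0 < τ)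
    (hτbound : τ * (opNorm H ^ 2 * opNorm M ^ 2 *
        (1 - (k : ℝ) * opNorm B ^ (k - 1) + ((k : ℝ) - 1) * opNorm B ^ k) /
        ((1 - opNorm B) ^ 2 * (1 - opNorm B ^ k) ^ 2) - α / 2) < 1) :
    ∀ lam : ℝ, lam ≠ 1 → 1 ≤ |lam| →
      ∀ y : Fin nσ → ℂ, eNorm y = 1 →
        ((1 + τ * α : ℝ) : ℂ) * (lam : ℂ) ^ 2 - (lam : ℂ) + (τ : ℂ) *
          (star y ⬝ᵥ ((M.map Complex.ofReal)ᵀ *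
            ((1 : Matrix (Fin nu) (Fin nu) ℂ) -
              ((lam : ℂ))⁻¹ • ((B.map Complex.ofReal)ᵀ) ^ k)⁻¹ *
            (((lam : ℂ) - 1) • (Xmat B H k).map Complex.ofReal +
              ((Tmat B k).map Complex.ofReal)ᵀ * (H.map Complex.ofReal)ᵀ *
                (H.map Complex.ofReal) * (Tmat B k).map Complex.ofReal) *
            ((1 : Matrix (Fin nu) (Fin nu) ℂ) -
              ((lam : ℂ))⁻¹ • (B.map Complex.ofReal) ^ k)⁻¹ *
            (M.map Complex.ofReal)).mulVec y) ≠ 0 := by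
  intro lam hne hlam y hy
  set Bc := B.map Complex.ofReal
  set Mc := M.map Complex.ofReal
  set Hc := H.map Complex.ofReal
  set Tc := (Tmat B k).map Complex.ofReal with hTc
  set Xc := (Xmat B H k).map Complex.ofReal
  set R := (1 - (lam : ℂ)⁻¹ • Bc ^ k)⁻¹ with hR
  set w := (R * Mc) *ᵥ y with hw
  have hRt : (1 - (lam : ℂ)⁻¹ • Bcᵀ ^ k)⁻¹ = Rᴴ := by
    rw [hR, conjTranspose_nonsing_inv, conjTranspose_sub, conjTranspose_one, conjTranspose_smul,
      conjTranspose_pow, map_ofReal_transpose B]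
    simp [Bc]
  have hform : star y ⬝ᵥ ((Mcᵀ * (1 - (lam : ℂ)⁻¹ • Bcᵀ ^ k)⁻¹ *
      (((lam : ℂ) - 1) • Xc + Tcᵀ * Hcᵀ * Hc * Tc) * R * Mc) *ᵥ y) =
      ((lam : ℂ) - 1) * (star w ⬝ᵥ (Xc *ᵥ w)) + ((eNorm ((Hc * Tc) *ᵥ w) ^ 2 : ℝ) : ℂ) := by
    have hTH : Tcᵀ * Hcᵀ * Hc * Tc = (Hc * Tc)ᴴ * (Hc * Tc) := by
      rw [map_ofReal_transpose H, hTc, map_ofReal_transpose (Tmat B k), conjTranspose_mul]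
      simp only [Matrix.mul_assoc, Hc]
    have hMR : Mcᵀ * Rᴴ = (R * Mc)ᴴ := by
      rw [map_ofReal_transpose M, conjTranspose_mul]
    rw [hRt, hTH, hMR, Matrix.mul_assoc, Matrix.mul_assoc,
      star_dotProduct_conjTranspose_mul_mulVec, ← hw, ← mulVec_mulVec, ← hw, add_mulVec,
      smul_mulVec, dotProduct_add, dotProduct_smul, star_dotProduct_conjTranspose_mul_mulVec,
      star_dotProduct_self, smul_eq_mul]
    rfl
  set b := opNorm B
  have hb0 : 0 ≤ b := opNorm_nonneg B
  have hbk : b ^ k < 1 := pow_lt_one₀ hb0 hB (by omega)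
  have hwM : eNorm w ≤ opNorm M / (1 - b ^ k) := by
    rw [le_div_iff₀ (sub_pos.mpr hbk), hw, ← mulVec_mulVec]
    have hc : ‖(lam : ℂ)⁻¹‖ ≤ 1 := by
      rw [norm_inv, Complex.norm_real, Real.norm_eq_abs]
      exact inv_le_one_of_one_le₀ hlam
    refine (eNorm_resolvent_mulVec_le B k hc _).trans ?_
    simpa [hy] using eNorm_map_ofReal_mulVec_le M y
  set S := ∑ l ∈ Finset.Ico 1 k, (l : ℝ) * b ^ (l - 1)
  have hS0 : 0 ≤ S := Finset.sum_nonneg fun l _ => by positivity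
  have hX : ‖star w ⬝ᵥ (Xc *ᵥ w)‖ ≤ opNorm H ^ 2 * opNorm M ^ 2 *
      (1 - (k : ℝ) * b ^ (k - 1) + ((k : ℝ) - 1) * b ^ k) / ((1 - b) ^ 2 * (1 - b ^ k) ^ 2) := by
    refine (norm_star_dotProduct_Xmat_le B H k w).trans ?_
    refine (mul_le_mul_of_nonneg_left (pow_le_pow_left₀ (eNorm_nonneg w) hwM 2)
      (by positivity)).trans (le_of_eq ?_)
    rw [← sum_Ico_mul_pow_mul_one_sub_sq b hk]
    have h1 : 1 - b ≠ 0 := (sub_pos.mpr hB).ne'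
    have h2 : 1 - b ^ k ≠ 0 := (sub_pos.mpr hbk).ne'
    field_simp
    exact mul_right_comm _ _ _
  have hq : |τ * (star w ⬝ᵥ (Xc *ᵥ w)).re| < 1 + τ * α / 2 := by
    rw [abs_mul, abs_of_pos hτ]
    have := mul_le_mul_of_nonneg_left ((Complex.abs_re_le_norm _).trans hX) hτ.le
    rw [mul_sub] at hτbound
    linarith
  have hpos := quadratic_pos_of_abs_lt (mul_nonneg hτ.le hα) hq
    (mul_nonneg hτ.le (sq_nonneg (eNorm ((Hc * Tc) *ᵥ w)))) hne hlam
  rw [hform]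
  intro h0
  refine hpos.ne' ?_
  have hre := congrArg Complex.re h0
  simp only [← Complex.ofReal_one, ← Complex.ofReal_sub, ← Complex.ofReal_pow, Complex.add_re,
    Complex.sub_re, Complex.re_ofReal_mul, Complex.ofReal_re, Complex.zero_re] at hre
  linarith
end
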